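/- arXiv:2307.02597 — 2 statements merged into one kernel-verified Lean document; each statement's English description precedes it below -/
import Mathlib

section
/- Let a < b be real numbers, let G̃ : [a,b] × [a,b] → ℝ be defined by G̃(x,s) = −(b−x)(s−a)/(b−a) if a ≤ s ≤ x ≤ b and G̃(x,s) = −(b−s)(x−a)/(b−a) if a ≤ x ≤ s ≤ b, define G(x,s) = ∫ₐᵇ G̃(x,t) G̃(t,s) dt, and let h : [a,b] → ℝ be continuous. Then the function u(x) = ∫ₐᵇ G(x,s) h(s) ds is four-times continuously differentiable on [a,b], satisfies u⁗(x) = h(x) for all x ∈ [a,b], and satisfies u(a) = u(b) = u''(a) = u''(b) = 0. -/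
open Set intervalIntegral

/-- The Green's function of the second-order BVP `y'' = h`, `y a = y b = 0`. -/
noncomputable def Gt (a b x s : ℝ) : ℝ :=
  if s ≤ x then -((b - x) * (s - a)) / (b - a) else -((b - s) * (x - a)) / (b - a)

/-- The Green's function `G(x,s) = ∫ₐᵇ G̃(x,t) G̃(t,s) dt` of the fourth-order BVP. -/
noncomputable def Gker (a b x s : ℝ) : ℝ := ∫ t in a..b, Gt a b x t * Gt a b t s

theorem continuous_Gt (a b : ℝ) : Continuous fun p : ℝ × ℝ => Gt a b p.1 p.2 := by
  unfold Gt
  refine Continuous.if_le ?_ ?_ continuous_snd continuous_fst ?_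
  · fun_prop
  · fun_prop
  · intro p hp
    rw [hp]

/-- The solution of `y'' = g`, `y a = y b = 0`, written without case distinction. -/
noncomputable def dirichletSolution (a b : ℝ) (g : ℝ → ℝ) (x : ℝ) : ℝ :=
  -((b - x) * (∫ s in a..x, (s - a) * g s) - (x - a) * ∫ s in b..x, (b - s) * g s) / (b - a)

/-- The derivative of `dirichletSolution`. -/
noncomputable def dirichletSolutionDeriv (a b : ℝ) (g : ℝ → ℝ) (x : ℝ) : ℝ :=
  ((∫ s in a..x, (s - a) * g s) + ∫ s in b..x, (b - s) * g s) / (b - a)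

theorem hasDerivAt_dirichletSolution (a b : ℝ) {g : ℝ → ℝ} (hg : Continuous g) (x : ℝ) :
    HasDerivAt (dirichletSolution a b g) (dirichletSolutionDeriv a b g x) x := by
  have h₁ : HasDerivAt (fun x => ∫ s in a..x, (s - a) * g s) ((x - a) * g x) x :=
    Continuous.integral_hasStrictDerivAt (by fun_prop) a x |>.hasDerivAt
  have h₂ : HasDerivAt (fun x => ∫ s in b..x, (b - s) * g s) ((b - x) * g x) x :=
    Continuous.integral_hasStrictDerivAt (by fun_prop) b x |>.hasDerivAt
  have := (((((hasDerivAt_id x).const_sub b).mul h₁).sub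
    (((hasDerivAt_id x).sub_const a).mul h₂)).neg).div_const (b - a)
  refine this.congr_deriv ?_
  simp only [dirichletSolutionDeriv, id]
  ring

theorem hasDerivAt_dirichletSolutionDeriv {a b : ℝ} (hab : a < b) {g : ℝ → ℝ}
    (hg : Continuous g) (x : ℝ) :
    HasDerivAt (dirichletSolutionDeriv a b g) (g x) x := by
  have h₁ : HasDerivAt (fun x => ∫ s in a..x, (s - a) * g s) ((x - a) * g x) x :=
    Continuous.integral_hasStrictDerivAt (by fun_prop) a x |>.hasDerivAt
  have h₂ : HasDerivAt (fun x => ∫ s in b..x, (b - s) * g s) ((b - x) * g x) x :=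
    Continuous.integral_hasStrictDerivAt (by fun_prop) b x |>.hasDerivAt
  refine ((h₁.add h₂).div_const (b - a)).congr_deriv ?_
  have : b - a ≠ 0 := (sub_pos.2 hab).ne'
  field_simp
  ring

theorem iteratedDeriv_two_dirichletSolution {a b : ℝ} (hab : a < b) {g : ℝ → ℝ}
    (hg : Continuous g) : iteratedDeriv 2 (dirichletSolution a b g) = g := by
  rw [iteratedDeriv_succ, iteratedDeriv_one,
    funext fun x => (hasDerivAt_dirichletSolution a b hg x).deriv]
  exact funext fun x => (hasDerivAt_dirichletSolutionDeriv hab hg x).deriv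

theorem contDiff_dirichletSolution {a b : ℝ} (hab : a < b) {g : ℝ → ℝ} {n : ℕ}
    (hg : ContDiff ℝ n g) : ContDiff ℝ (n + 2 : ℕ) (dirichletSolution a b g) := by
  have hc := hg.continuous
  have h₁ : ContDiff ℝ (n + 1 : ℕ) (dirichletSolutionDeriv a b g) := by
    push_cast
    rw [contDiff_succ_iff_deriv]
    refine ⟨fun x => (hasDerivAt_dirichletSolutionDeriv hab hc x).differentiableAt, by simp, ?_⟩
    rwa [funext fun x => (hasDerivAt_dirichletSolutionDeriv hab hc x).deriv]
  rw [show n + 2 = (n + 1) + 1 from rfl, Nat.cast_succ, contDiff_succ_iff_deriv]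
  refine ⟨fun x => (hasDerivAt_dirichletSolution a b hc x).differentiableAt, by simp, ?_⟩
  rwa [funext fun x => (hasDerivAt_dirichletSolution a b hc x).deriv]

theorem dirichletSolution_left (a b : ℝ) (g : ℝ → ℝ) : dirichletSolution a b g a = 0 := by
  simp [dirichletSolution]

theorem dirichletSolution_right (a b : ℝ) (g : ℝ → ℝ) : dirichletSolution a b g b = 0 := by
  simp [dirichletSolution]

theorem integral_Gt_mul {a b x : ℝ} {g : ℝ → ℝ} (hg : Continuous g) (hx : x ∈ Icc a b) :
    ∫ s in a..b, Gt a b x s * g s = dirichletSolution a b g x := by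
  have hG : Continuous fun s => Gt a b x s * g s :=
    ((continuous_Gt a b).comp (by fun_prop : Continuous fun s : ℝ => (x, s))).mul hg
  have h₁ : ∫ s in a..x, Gt a b x s * g s =
      -(b - x) / (b - a) * ∫ s in a..x, (s - a) * g s := by
    rw [← integral_const_mul]
    refine integral_congr fun s hs => ?_
    rw [uIcc_of_le hx.1] at hs
    simp only [Gt, if_pos hs.2]
    ring
  have h₂ : ∫ s in x..b, Gt a b x s * g s =
      -(x - a) / (b - a) * ∫ s in x..b, (b - s) * g s := by
    rw [← integral_const_mul]
    refine integral_congr fun s hs => ?_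
    rw [uIcc_of_le hx.2] at hs
    rcases hs.1.eq_or_lt with rfl | hlt
    · simp only [Gt, le_refl, if_true]
      ring
    · simp only [Gt, if_neg hlt.not_ge]
      ring
  rw [← integral_add_adjacent_intervals (hG.intervalIntegrable a x) (hG.intervalIntegrable x b),
    h₁, h₂, dirichletSolution, integral_symm b x]
  ring

theorem integral_Gker_mul {a b x : ℝ} (hab : a < b) {g : ℝ → ℝ} (hg : Continuous g)
    (hx : x ∈ Icc a b) :
    ∫ s in a..b, Gker a b x s * g s =
      dirichletSolution a b (dirichletSolution a b g) x := by
  have hsol : Continuous (dirichletSolution a b g) :=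
    continuous_iff_continuousAt.2 fun y => (hasDerivAt_dirichletSolution a b hg y).continuousAt
  have hG := continuous_Gt a b
  have hF : Continuous fun p : ℝ × ℝ => Gt a b x p.2 * Gt a b p.2 p.1 * g p.1 :=
    ((hG.comp (by fun_prop : Continuous fun p : ℝ × ℝ => (x, p.2))).mul
      (hG.comp (by fun_prop : Continuous fun p : ℝ × ℝ => (p.2, p.1)))).mul (by fun_prop)
  calc ∫ s in a..b, Gker a b x s * g s
      = ∫ s in a..b, ∫ t in a..b, Gt a b x t * Gt a b t s * g s := by
        simp only [Gker, integral_mul_const]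
    _ = ∫ t in a..b, ∫ s in a..b, Gt a b x t * Gt a b t s * g s :=
        MeasureTheory.intervalIntegral_intervalIntegral_swap <|
          (hF.continuousOn.integrableOn_compact (isCompact_uIcc.prod isCompact_uIcc)).mono_set
            (prod_mono uIoc_subset_uIcc uIoc_subset_uIcc)
    _ = ∫ t in a..b, Gt a b x t * dirichletSolution a b g t := by
        refine integral_congr fun t ht => ?_
        rw [uIcc_of_le hab.le] at ht
        simp only [mul_assoc, integral_const_mul, integral_Gt_mul hg ht]
    _ = _ := integral_Gt_mul hsol hx

/-- For continuous `h`, the function `u x = ∫ₐᵇ G(x,s) h(s) ds` is four-times continuously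
differentiable on `[a,b]`, satisfies `u⁗ = h` on `[a,b]`, and
`u a = u b = u'' a = u'' b = 0`. -/
theorem Gker_solves_fourth_order_bvp (a b : ℝ) (hab : a < b)
    (h : ℝ → ℝ) (hh : ContinuousOn h (Set.Icc a b)) :
    ContDiffOn ℝ 4 (fun x => ∫ s in a..b, Gker a b x s * h s) (Set.Icc a b) ∧
    (∀ x ∈ Set.Icc a b,
      iteratedDerivWithin 4 (fun x => ∫ s in a..b, Gker a b x s * h s) (Set.Icc a b) x = h x) ∧
    (∫ s in a..b, Gker a b a s * h s) = 0 ∧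
    (∫ s in a..b, Gker a b b s * h s) = 0 ∧
    iteratedDerivWithin 2 (fun x => ∫ s in a..b, Gker a b x s * h s) (Set.Icc a b) a = 0 ∧
    iteratedDerivWithin 2 (fun x => ∫ s in a..b, Gker a b x s * h s) (Set.Icc a b) b = 0 := by
  set U := fun x => ∫ s in a..b, Gker a b x s * h s
  set g : ℝ → ℝ := IccExtend hab.le ((Icc a b).domRestrict h)
  have hg : Continuous g := hh.domRestrict.Icc_extend'
  have hgh : ∀ x ∈ Icc a b, g x = h x := fun x hx => IccExtend_of_mem hab.le _ hx
  have ha : a ∈ Icc a b := left_mem_Icc.2 hab.le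
  have hb : b ∈ Icc a b := right_mem_Icc.2 hab.le
  have hud : UniqueDiffOn ℝ (Icc a b) := uniqueDiffOn_Icc hab
  set v := dirichletSolution a b g
  set w := dirichletSolution a b v
  have hUw : EqOn U w (Icc a b) := by
    intro x hx
    refine Eq.trans ?_ (integral_Gker_mul hab hg hx)
    refine integral_congr fun s hs => ?_
    rw [uIcc_of_le hab.le] at hs
    simp only [hgh s hs]
  have hv : ContDiff ℝ 2 v := contDiff_dirichletSolution (n := 0) hab (contDiff_zero.2 hg)
  have hw : ContDiff ℝ 4 w := contDiff_dirichletSolution (n := 2) hab hv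
  have hw₂ : iteratedDeriv 2 w = v := iteratedDeriv_two_dirichletSolution hab hv.continuous
  have hw₄ : iteratedDeriv 4 w = g := by
    rw [← iteratedDeriv_two_dirichletSolution hab hg]
    change _ = iteratedDeriv 2 v
    simp only [← hw₂, iteratedDeriv_eq_iterate, ← Function.iterate_add_apply]
  have hU₂ : ∀ x ∈ Icc a b, iteratedDerivWithin 2 U (Icc a b) x = v x := by
    intro x hx
    rw [iteratedDerivWithin_congr hUw hx, iteratedDerivWithin_eq_iteratedDeriv hud
      (hw.contDiffAt.of_le (by norm_num)) hx, hw₂]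
  refine ⟨hw.contDiffOn.congr hUw, fun x hx => ?_, ?_, ?_, ?_, ?_⟩
  · rw [iteratedDerivWithin_congr hUw hx,
      iteratedDerivWithin_eq_iteratedDeriv hud hw.contDiffAt hx, hw₄, hgh x hx]
  · exact (hUw ha).trans (dirichletSolution_left a b v)
  · exact (hUw hb).trans (dirichletSolution_right a b v)
  · exact (hU₂ a ha).trans (dirichletSolution_left a b g)
  · exact (hU₂ b hb).trans (dirichletSolution_right a b g)
end

section
/- Let a < b, N ∈ ℕ with N ≥ 2, h = (b−a)/(N+1), K ≥ 0, let 𝓐 be the N×N symmetric positive definite pentadiagonal matrix with diagonal (5, 6, …, 6, 5), first off-diagonals −4, and second off-diagonals 1, and let 𝓑̄, 𝓖 ∈ ℝᴺ. Define the sequence Wʲ ∈ ℝᴺ by choosing W⁰ ∈ ℝᴺ arbitrarily and setting Wʲ = (𝓐 + (h⁴K/2) I)⁻¹(𝓑̄ + (h⁴K/2) 𝓖) − (h⁴K/2)(𝓐 + (h⁴K/2) I)⁻¹ |Wʲ⁻¹ − 𝓖| for j ≥ 1. Then there is a unique W* ∈ ℝᴺ satisfying (𝓐 + (h⁴K/2)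 I) W* = 𝓑̄ + (h⁴K/2) 𝓖 − (h⁴K/2) |W* − 𝓖|, the sequence Wʲ converges to W*, and with 𝓒 = (b−a)⁴K / ((b−a)⁴K + 32) one has ‖Wʲ − W*‖₂ ≤ 𝓒ʲ (1/(1−𝓒)) ‖W¹ − W⁰‖₂ for all j ≥ 1. -/
open Matrix Filter

/-- The `N × N` pentadiagonal finite-difference matrix `𝓐` with diagonal `(5, 6, …, 6, 5)`,
first off-diagonals `−4`, and second off-diagonals `1`. -/
def penta (N : ℕ) : Matrix (Fin N) (Fin N) ℝ :=
  Matrix.of fun i j =>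
    if i = j then (if i.val = 0 ∨ i.val = N - 1 then 5 else 6)
    else if i.val + 1 = j.val ∨ j.val + 1 = i.val then -4
    else if i.val + 2 = j.val ∨ j.val + 2 = i.val then 1
    else 0

/-- Componentwise absolute value of a vector in Euclidean space. -/
noncomputable def absVec {N : ℕ} (v : EuclideanSpace ℝ (Fin N)) : EuclideanSpace ℝ (Fin N) :=
  (EuclideanSpace.equiv (Fin N) ℝ).symm fun i => |v i|

/-- The extension by zero of a vector `v`, shifted so that `v` occupies the indices `1, …, N`. -/
def zeroExt {N : ℕ} (v : Fin N → ℝ) (k : ℕ) : ℝ :=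
  if hk : 1 ≤ k ∧ k ≤ N then v ⟨k - 1, by omega⟩ else 0

/-- The `N × N` second-difference matrix `tridiag(−1, 2, −1)`. -/
def secondDiff (N : ℕ) : Matrix (Fin N) (Fin N) ℝ :=
  Matrix.of fun i j =>
    if i = j then 2 else if i.val + 1 = j.val ∨ j.val + 1 = i.val then -1 else 0

lemma zeroExt_zero {N : ℕ} (v : Fin N → ℝ) : zeroExt v 0 = 0 := by simp [zeroExt]

lemma zeroExt_last {N : ℕ} (v : Fin N → ℝ) : zeroExt v (N + 1) = 0 := by simp [zeroExt]

lemma zeroExt_succ {N : ℕ} (v : Fin N → ℝ) (i : Fin N) : zeroExt v (i + 1) = v i := by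
  simp [zeroExt]

lemma sum_ite_succ_eq_zeroExt {N : ℕ} (v : Fin N → ℝ) (k : ℕ) :
    ∑ j : Fin N, (if j.val + 1 = k then v j else 0) = zeroExt v k := by
  unfold zeroExt
  split_ifs with hk
  · rw [Finset.sum_eq_single ⟨k - 1, by omega⟩]
    · simp [Nat.sub_add_cancel hk.1]
    · intro j _ hj
      rw [if_neg]
      intro hjk
      exact hj (Fin.ext (by simp; omega))
    · simp
  · refine Finset.sum_eq_zero fun j _ => if_neg ?_
    have := j.isLt
    omega

lemma secondDiff_mulVec {N : ℕ} (v : Fin N → ℝ) (i : Fin N) :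
    (secondDiff N *ᵥ v) i = 2 * zeroExt v (i + 1) - zeroExt v i - zeroExt v (i + 2) := by
  simp only [← sum_ite_succ_eq_zeroExt, mulVec, dotProduct, secondDiff, of_apply,
    Finset.mul_sum, ← Finset.sum_sub_distrib]
  refine Finset.sum_congr rfl fun j _ => ?_
  simp only [Fin.ext_iff]
  split_ifs <;> first | omega | ring

lemma secondDiff_mul_self {N : ℕ} (hN : 2 ≤ N) : secondDiff N * secondDiff N = penta N := by
  ext i j
  have hmul : (secondDiff N * secondDiff N) i j
      = (secondDiff N *ᵥ fun k => secondDiff N k j) i := rfl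
  rw [hmul, secondDiff_mulVec]
  have hi := i.isLt
  have hj := j.isLt
  simp only [zeroExt, secondDiff, penta, of_apply, Fin.ext_iff]
  grind

lemma secondDiff_transpose (N : ℕ) : (secondDiff N)ᵀ = secondDiff N := by
  ext i j
  simp only [secondDiff, transpose_apply, of_apply, Fin.ext_iff]
  grind

lemma sum_mul_second_difference (u : ℕ → ℝ) (n : ℕ) :
    ∑ i ∈ Finset.range n, u (i + 1) * (2 * u (i + 1) - u i - u (i + 2)) =
      ∑ i ∈ Finset.range (n + 1), (u (i + 1) - u i) ^ 2 + u 0 * (u 1 - u 0)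
        - u (n + 1) * (u (n + 1) - u n) := by
  induction n with
  | zero => simp; ring
  | succ n ih => rw [Finset.sum_range_succ, ih, Finset.sum_range_succ _ (n + 1)]; ring

lemma four_mul_sq_le_sum_sq_difference (u : ℕ → ℝ) (n k : ℕ) (hk : k ≤ n) (h0 : u 0 = 0)
    (hn : u n = 0) :
    4 * u k ^ 2 ≤ n * ∑ i ∈ Finset.range n, (u (i + 1) - u i) ^ 2 := by
  have hleft : |u k| ≤ ∑ i ∈ Finset.range k, |u (i + 1) - u i| := by
    have := Finset.abs_sum_le_sum_abs (fun i => u (i + 1) - u i) (Finset.range k)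
    rwa [Finset.sum_range_sub, h0, sub_zero] at this
  have hright : |u k| ≤ ∑ i ∈ Finset.Ico k n, |u (i + 1) - u i| := by
    have := Finset.abs_sum_le_sum_abs (fun i => u (i + 1) - u i) (Finset.Ico k n)
    rwa [Finset.sum_Ico_sub _ hk, hn, zero_sub, abs_neg] at this
  have htot : 2 * |u k| ≤ ∑ i ∈ Finset.range n, |u (i + 1) - u i| := by
    rw [← Finset.sum_range_add_sum_Ico _ hk]
    linarith
  have hcs := sq_sum_le_card_mul_sum_sq (s := Finset.range n) (f := fun i => |u (i + 1) - u i|)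
  simp only [Finset.card_range, sq_abs] at hcs
  calc 4 * u k ^ 2 = (2 * |u k|) ^ 2 := by rw [mul_pow, sq_abs]; norm_num
    _ ≤ _ := pow_le_pow_left₀ (by positivity) htot 2
    _ ≤ _ := hcs

lemma le_dotProduct_secondDiff {N : ℕ} (v : Fin N → ℝ) :
    4 / ((N : ℝ) + 1) ^ 2 * (v ⬝ᵥ v) ≤ v ⬝ᵥ (secondDiff N *ᵥ v) := by
  have hform : v ⬝ᵥ (secondDiff N *ᵥ v) =
      ∑ i ∈ Finset.range (N + 1), (zeroExt v (i + 1) - zeroExt v i) ^ 2 := by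
    have := sum_mul_second_difference (zeroExt v) N
    rw [zeroExt_zero, zeroExt_last, ← Fin.sum_univ_eq_sum_range
      (fun i => zeroExt v (i + 1) * (2 * zeroExt v (i + 1) - zeroExt v i - zeroExt v (i + 2)))]
      at this
    simp only [dotProduct, secondDiff_mulVec]
    simp only [zeroExt_succ] at this ⊢
    linarith
  rw [hform]
  set D := ∑ i ∈ Finset.range (N + 1), (zeroExt v (i + 1) - zeroExt v i) ^ 2
  have hD : 0 ≤ D := Finset.sum_nonneg fun i _ => sq_nonneg _
  have hsum : 4 * (v ⬝ᵥ v) ≤ N * ((N + 1) * D) := by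
    have hbound : ∀ i : Fin N, 4 * (v i * v i) ≤ (N + 1) * D := fun i => by
      have := four_mul_sq_le_sum_sq_difference (zeroExt v) (N + 1) (i + 1) (by omega)
        (zeroExt_zero v) (zeroExt_last v)
      rw [zeroExt_succ] at this
      push_cast at this
      linarith
    have := Finset.sum_le_sum fun (i : Fin N) (_ : i ∈ Finset.univ) => hbound i
    simpa [dotProduct, Finset.mul_sum] using this
  rw [div_mul_eq_mul_div, div_le_iff₀ (by positivity)]
  nlinarith [mul_nonneg (by positivity : (0 : ℝ) ≤ (N : ℝ) + 1) hD]

lemma le_dotProduct_penta {N : ℕ} (hN : 2 ≤ N) (v : Fin N → ℝ) :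
    16 / ((N : ℝ) + 1) ^ 4 * (v ⬝ᵥ v) ≤ v ⬝ᵥ (penta N *ᵥ v) := by
  have hsq : v ⬝ᵥ (penta N *ᵥ v) = (secondDiff N *ᵥ v) ⬝ᵥ (secondDiff N *ᵥ v) := by
    rw [← secondDiff_mul_self hN, ← mulVec_mulVec, dotProduct_mulVec, ← mulVec_transpose,
      secondDiff_transpose]
  have hle := le_dotProduct_secondDiff v
  set c := 4 / ((N : ℝ) + 1) ^ 2 with hc
  have hc2 : 16 / ((N : ℝ) + 1) ^ 4 = c ^ 2 := by rw [hc, div_pow, ← pow_mul]; norm_num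
  have hc0 : 0 ≤ c := by positivity
  have hnonneg : 0 ≤ (secondDiff N *ᵥ v - c • v) ⬝ᵥ (secondDiff N *ᵥ v - c • v) :=
    Finset.sum_nonneg fun i _ => mul_self_nonneg _
  simp only [sub_dotProduct, dotProduct_sub, smul_dotProduct, dotProduct_smul, smul_eq_mul,
    dotProduct_comm (secondDiff N *ᵥ v) v] at hnonneg
  rw [hsq, hc2]
  nlinarith [mul_le_mul_of_nonneg_left hle hc0]

lemma norm_le_norm_penta_add_smul_one {N : ℕ} (hN : 2 ≤ N) (κ : ℝ)
    (x : EuclideanSpace ℝ (Fin N)) :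
    (16 / ((N : ℝ) + 1) ^ 4 + κ) * ‖x‖ ≤
      ‖Matrix.toEuclideanCLM (𝕜 := ℝ) (n := Fin N)
        (penta N + κ • (1 : Matrix (Fin N) (Fin N) ℝ)) x‖ := by
  rcases eq_or_ne x 0 with rfl | hx
  · simp
  have hpos : 0 < ‖x‖ := norm_pos_iff.mpr hx
  refine le_of_mul_le_mul_right ?_ hpos
  set y := Matrix.toEuclideanCLM (𝕜 := ℝ) (n := Fin N)
    (penta N + κ • (1 : Matrix (Fin N) (Fin N) ℝ)) x with hy
  have hin : inner ℝ y x = x.ofLp ⬝ᵥ (penta N *ᵥ x.ofLp) + κ * (x.ofLp ⬝ᵥ x.ofLp) := by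
    rw [EuclideanSpace.inner_eq_star_dotProduct, hy, Matrix.ofLp_toEuclideanCLM]
    simp [add_mulVec, smul_mulVec]
  have hnorm : ‖x‖ * ‖x‖ = x.ofLp ⬝ᵥ x.ofLp := by
    rw [← real_inner_self_eq_norm_mul_norm, EuclideanSpace.inner_eq_star_dotProduct]
    simp
  calc (16 / ((N : ℝ) + 1) ^ 4 + κ) * ‖x‖ * ‖x‖
      = 16 / ((N : ℝ) + 1) ^ 4 * (x.ofLp ⬝ᵥ x.ofLp) + κ * (x.ofLp ⬝ᵥ x.ofLp) := by
        rw [mul_assoc, hnorm, add_mul]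
    _ ≤ inner ℝ y x := by rw [hin]; gcongr; exact le_dotProduct_penta hN _
    _ ≤ ‖y‖ * ‖x‖ := real_inner_le_norm y x

lemma isUnit_penta_add_smul_one {N : ℕ} (hN : 2 ≤ N) {κ : ℝ} (hκ : 0 ≤ κ) :
    IsUnit (penta N + κ • (1 : Matrix (Fin N) (Fin N) ℝ)) := by
  rw [← Matrix.mulVec_injective_iff_isUnit, ← Matrix.coe_mulVecLin,
    injective_iff_map_eq_zero]
  intro v hv
  have hbound := norm_le_norm_penta_add_smul_one hN κ (WithLp.toLp 2 v)
  rw [Matrix.mulVecLin_apply] at hv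
  rw [Matrix.toEuclideanCLM_toLp, hv, WithLp.toLp_zero, norm_zero] at hbound
  have hc : 0 < 16 / ((N : ℝ) + 1) ^ 4 + κ := by positivity
  have hzero : ‖WithLp.toLp 2 v‖ ≤ 0 := nonpos_of_mul_nonpos_right hbound hc
  simpa using hzero

lemma norm_absVec_sub_absVec_le {N : ℕ} (x y : EuclideanSpace ℝ (Fin N)) :
    ‖absVec x - absVec y‖ ≤ ‖x - y‖ := by
  rw [EuclideanSpace.norm_eq, EuclideanSpace.norm_eq]
  refine Real.sqrt_le_sqrt (Finset.sum_le_sum fun i _ => ?_)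
  exact pow_le_pow_left₀ (norm_nonneg _) (abs_abs_sub_abs_le (x i) (y i)) 2

/-- The fixed-point iterations
`Wʲ = (𝓐 + (h⁴K/2)I)⁻¹(𝓑̄ + (h⁴K/2)𝓖) − (h⁴K/2)(𝓐 + (h⁴K/2)I)⁻¹|Wʲ⁻¹ − 𝓖|`
converge to the unique solution `W*` of the absolute value equation
`(𝓐 + (h⁴K/2)I)W* = 𝓑̄ + (h⁴K/2)𝓖 − (h⁴K/2)|W* − 𝓖|`, with the geometric error bound
`‖Wʲ − W*‖₂ ≤ 𝓒ʲ (1/(1−𝓒)) ‖W¹ − W⁰‖₂` where `𝓒 = (b−a)⁴K/((b−a)⁴K + 32)`. -/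
theorem fixed_point_iterations (a b : ℝ) (hab : a < b) (N : ℕ) (hN : 2 ≤ N) (K : ℝ)
    (hK : 0 ≤ K) (h : ℝ) (hh : h = (b - a) / (N + 1)) (B G : EuclideanSpace ℝ (Fin N))
    (C : ℝ) (hC : C = (b - a) ^ 4 * K / ((b - a) ^ 4 * K + 32))
    (W : ℕ → EuclideanSpace ℝ (Fin N))
    (hW : ∀ j : ℕ, W (j + 1) =
      Matrix.toEuclideanCLM (𝕜 := ℝ) (n := Fin N)
          ((penta N + (h ^ 4 * K / 2) • (1 : Matrix (Fin N) (Fin N) ℝ))⁻¹)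
          (B + (h ^ 4 * K / 2) • G) -
        (h ^ 4 * K / 2) •
          Matrix.toEuclideanCLM (𝕜 := ℝ) (n := Fin N)
            ((penta N + (h ^ 4 * K / 2) • (1 : Matrix (Fin N) (Fin N) ℝ))⁻¹)
            (absVec (W j - G))) :
    (∃! Wstar : EuclideanSpace ℝ (Fin N),
      Matrix.toEuclideanCLM (𝕜 := ℝ) (n := Fin N)
          (penta N + (h ^ 4 * K / 2) • (1 : Matrix (Fin N) (Fin N) ℝ)) Wstar =
        B + (h ^ 4 * K / 2) • G - (h ^ 4 * K / 2) • absVec (Wstar - G)) ∧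
    (∀ Wstar : EuclideanSpace ℝ (Fin N),
      Matrix.toEuclideanCLM (𝕜 := ℝ) (n := Fin N)
          (penta N + (h ^ 4 * K / 2) • (1 : Matrix (Fin N) (Fin N) ℝ)) Wstar =
        B + (h ^ 4 * K / 2) • G - (h ^ 4 * K / 2) • absVec (Wstar - G) →
      Tendsto W atTop (nhds Wstar) ∧
      ∀ j : ℕ, 1 ≤ j →
        ‖W j - Wstar‖ ≤ C ^ j * (1 / (1 - C)) * ‖W 1 - W 0‖) := by
  set κ := h ^ 4 * K / 2 with hκdef
  set M := penta N + κ • (1 : Matrix (Fin N) (Fin N) ℝ) with hM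
  have hκ : 0 ≤ κ := by positivity
  have hunit : IsUnit M.det := (Matrix.isUnit_iff_isUnit_det _).mp (isUnit_penta_add_smul_one hN hκ)
  set L := Matrix.toEuclideanCLM (𝕜 := ℝ) (n := Fin N) M with hL
  set R := Matrix.toEuclideanCLM (𝕜 := ℝ) (n := Fin N) M⁻¹ with hR
  have hLR : ∀ x, L (R x) = x := fun x => by
    rw [← mul_apply_eq_comp, hL, hR, ← map_mul, Matrix.mul_nonsing_inv _ hunit,
      map_one, one_apply_eq_self]
  have hRL : ∀ x, R (L x) = x := fun x => by
    rw [← mul_apply_eq_comp, hL, hR, ← map_mul, Matrix.nonsing_inv_mul _ hunit,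
      map_one, one_apply_eq_self]
  have hba : 0 < b - a := sub_pos.mpr hab
  have hP : 0 ≤ (b - a) ^ 4 * K := by positivity
  have hC0 : 0 ≤ C := by rw [hC]; positivity
  have hC1 : C < 1 := by rw [hC, div_lt_one (by positivity)]; linarith
  have hCκ : C * (16 / ((N : ℝ) + 1) ^ 4 + κ) = κ := by
    rw [hC, hκdef, hh]
    field_simp
    ring
  have hcontr : ∀ y, κ * ‖R y‖ ≤ C * ‖y‖ := fun y => by
    have := norm_le_norm_penta_add_smul_one hN κ (R y)
    rw [← hM, ← hL, hLR] at this
    calc κ * ‖R y‖ = C * ((16 / ((N : ℝ) + 1) ^ 4 + κ) * ‖R y‖) := by rw [← mul_assoc, hCκ]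
      _ ≤ C * ‖y‖ := by gcongr
  set F : EuclideanSpace ℝ (Fin N) → EuclideanSpace ℝ (Fin N) := fun x =>
    R (B + κ • G) - κ • R (absVec (x - G)) with hF
  have hFc : ContractingWith ⟨C, hC0⟩ F := by
    refine ⟨hC1, LipschitzWith.of_dist_le_mul fun x y => ?_⟩
    have hdiff : F x - F y = κ • R (absVec (y - G) - absVec (x - G)) := by
      rw [map_sub, smul_sub]
      simp only [hF]
      abel
    rw [dist_eq_norm, hdiff, norm_smul, Real.norm_of_nonneg hκ, dist_comm, dist_eq_norm]
    refine (hcontr _).trans (mul_le_mul_of_nonneg_left ?_ hC0)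
    simpa using norm_absVec_sub_absVec_le (y - G) (x - G)
  have hfix : ∀ x, L x = B + κ • G - κ • absVec (x - G) ↔ Function.IsFixedPt F x := fun x => by
    have hFx : F x = R (B + κ • G - κ • absVec (x - G)) := by simp only [hF, map_sub, map_smul]
    rw [Function.IsFixedPt, hFx]
    constructor
    · intro hx
      rw [← hx, hRL]
    · intro hx
      rw [← hLR (B + κ • G - κ • absVec (x - G)), hx]
  have hWF : ∀ j, W j = F^[j] (W 0) := fun j => by
    induction j with
    | zero => rfl
    | succ j ih => rw [Function.iterate_succ_apply', ← ih, hW j]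
  refine ⟨⟨hFc.fixedPoint F, (hfix _).mpr hFc.fixedPoint_isFixedPt,
    fun y hy => hFc.fixedPoint_unique ((hfix y).mp hy)⟩, fun Wstar hWstar => ?_⟩
  rw [hFc.fixedPoint_unique ((hfix Wstar).mp hWstar)]
  refine ⟨?_, fun j _ => ?_⟩
  · rw [funext hWF]
    exact hFc.tendsto_iterate_fixedPoint (W 0)
  · have hest := hFc.apriori_dist_iterate_fixedPoint_le (W 0) j
    have hone : F (W 0) = W 1 := (hW 0).symm
    rw [← hWF, hone, dist_eq_norm, dist_comm, dist_eq_norm] at hest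
    calc _ ≤ ‖W 1 - W 0‖ * C ^ j / (1 - C) := hest
      _ = _ := by ring
end
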